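/- Suppose the star-connected occupied component C(0) containing the origin is finite and nonempty. Then no three pairwise distinct outermost boundary cycles of C(0) (distinct cycles among {D_k : S_k ∈ C(0)}) share a common vertex. -/

import Mathlib

/-!
Common framework: tile ℝ² into closed unit squares indexed by `ℤ²`, with corners
forming a translate of `ℤ²` and the origin the centre of the square `S₀` (index `(0,0)`).
A cycle is identified with its edge set (a set of unordered pairs of corners);
its interior (resp. exterior) is the union of the bounded (resp. unbounded)
connected components of the complement of the closed curve it traces in the plane.
-/

/-- Corners of the grid squares, indexed by `ℤ²`. -/
abbrev GridV := ℤ × ℤ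

/-- Embedding of corners into the plane: the square of index `z` is
`[z₁ - 1/2, z₁ + 1/2] × [z₂ - 1/2, z₂ + 1/2]`, so the origin is the centre of `S₀`. -/
noncomputable def toPlane (v : GridV) : ℝ × ℝ := ((v.1 : ℝ) - 1 / 2, (v.2 : ℝ) - 1 / 2)

/-- The closed unit square of index `z`. -/
def squareSet (z : GridV) : Set (ℝ × ℝ) :=
  Set.Icc ((z.1 : ℝ) - 1 / 2, (z.2 : ℝ) - 1 / 2) ((z.1 : ℝ) + 1 / 2, (z.2 : ℝ) + 1 / 2)

/-- The four edges (unit segments) of the square of index `z`, as unordered pairs of corners. -/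
def squareEdges (z : GridV) : Set (Sym2 GridV) :=
  {s(z, z + (1, 0)), s(z + (1, 0), z + (1, 1)), s(z + (1, 1), z + (0, 1)), s(z + (0, 1), z)}

/-- Adjacency of corners in the full grid graph `G`: Euclidean distance one. -/
def GridAdj (u v : GridV) : Prop := |u.1 - v.1| + |u.2 - v.2| = 1

/-- A cycle in the full grid graph: a cyclic sequence `(v₀, …, v_{n-1}, v₀)` of
distinct corners with consecutive corners adjacent. -/
structure GridCycle where
  n : ℕ
  hn : 3 ≤ n
  f : ZMod n → GridV
  inj : Function.Injective f
  adj : ∀ i, GridAdj (f i) (f (i + 1))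

/-- The edge set of a grid cycle. -/
def GridCycle.edgeSet (C : GridCycle) : Set (Sym2 GridV) :=
  {e | ∃ i : ZMod C.n, e = s(C.f i, C.f (i + 1))}

/-- An edge set is (the edge set of) a cycle of the grid graph `G`.
We identify a cycle with its edge set. -/
def IsCycle (E : Set (Sym2 GridV)) : Prop := ∃ C : GridCycle, C.edgeSet = E

/-- A cycle of the subgraph of the grid graph with edge set `G`. -/
def IsCycleIn (G E : Set (Sym2 GridV)) : Prop := IsCycle E ∧ E ⊆ G

/-- The vertices incident to some edge of `E`. -/
def vertexSetOf (E : Set (Sym2 GridV)) : Set GridV := {v | ∃ e ∈ E, v ∈ e}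

/-- The closed segment in the plane realizing an edge. -/
noncomputable def edgeSeg : Sym2 GridV → Set (ℝ × ℝ) :=
  Sym2.lift ⟨fun a b => segment ℝ (toPlane a) (toPlane b), fun _ _ => segment_symm ℝ _ _⟩

/-- The closed curve in the plane traced by the edges of `E`. -/
noncomputable def carrierOf (E : Set (Sym2 GridV)) : Set (ℝ × ℝ) := ⋃ e ∈ E, edgeSeg e

/-- The interior of a cycle: the union of the bounded connected components of the
complement of its carrier curve. -/
noncomputable def interiorOf (E : Set (Sym2 GridV)) : Set (ℝ × ℝ) :=
  {p | p ∉ carrierOf E ∧ Bornology.IsBounded (connectedComponentIn (carrierOf E)ᶜ p)}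

/-- The exterior of a cycle: the union of the unbounded connected components of the
complement of its carrier curve. -/
noncomputable def exteriorOf (E : Set (Sym2 GridV)) : Set (ℝ × ℝ) :=
  {p | p ∉ carrierOf E ∧ ¬ Bornology.IsBounded (connectedComponentIn (carrierOf E)ᶜ p)}

/-- The set `A` is contained in the interior of the cycle `E` (points of the
curve itself being allowed, so that e.g. a square whose boundary edges lie on the
cycle counts as contained in the interior). -/
def inInterior (E : Set (Sym2 GridV)) (A : Set (ℝ × ℝ)) : Prop :=
  A ⊆ interiorOf E ∪ carrierOf E

/-- The set `A` lies in the exterior of the cycle `E` (points of the curve itself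
being allowed). -/
def inExterior (E : Set (Sym2 GridV)) (A : Set (ℝ × ℝ)) : Prop :=
  A ⊆ exteriorOf E ∪ carrierOf E

/-- Star adjacency: distinct squares sharing at least a corner. -/
def starAdj (z w : GridV) : Prop := z ≠ w ∧ |z.1 - w.1| ≤ 1 ∧ |z.2 - w.2| ≤ 1

/-- Plus adjacency: squares sharing an edge. -/
def plusAdj (z w : GridV) : Prop := |z.1 - w.1| + |z.2 - w.2| = 1

/-- The star-connected occupied component `C(0)` of the square `S₀` (of index `(0,0)`),
for the occupancy configuration `ω`; empty if `S₀` is vacant. -/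
def starComp (ω : GridV → Prop) : Set GridV :=
  {z | ω z ∧ Relation.ReflTransGen (fun a b => ω a ∧ ω b ∧ starAdj a b) (0, 0) z}

/-- The plus-connected occupied component `C⁺(0)` of the square `S₀`. -/
def plusComp (ω : GridV → Prop) : Set GridV :=
  {z | ω z ∧ Relation.ReflTransGen (fun a b => ω a ∧ ω b ∧ plusAdj a b) (0, 0) z}

/-- The edge set of the graph `G_C`: all edges of squares of `C(0)`. -/
def gcEdges (ω : GridV → Prop) : Set (Sym2 GridV) := ⋃ z ∈ starComp ω, squareEdges z

/-- The edge set of the graph `G⁺_C`: all edges of squares of `C⁺(0)`. -/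
def gpcEdges (ω : GridV → Prop) : Set (Sym2 GridV) := ⋃ z ∈ plusComp ω, squareEdges z

/-- `e` is an outermost boundary edge of the graph with edge set `G`: for every
cycle `E` in this graph, either `e` is an edge of `E` or `e` lies in the exterior of `E`. -/
def outermostBoundaryEdgeIn (G : Set (Sym2 GridV)) (e : Sym2 GridV) : Prop :=
  e ∈ G ∧ ∀ E, IsCycleIn G E → e ∈ E ∨ inExterior E (edgeSeg e)

/-- The subgraph spanned by the edge set `E` is connected: any two incident vertices
are joined by a walk using only edges of `E`. -/
def EdgeSetConnected (E : Set (Sym2 GridV)) : Prop :=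
  ∀ u v, u ∈ vertexSetOf E → v ∈ vertexSetOf E →
    ∃ p : List GridV, p.head? = some u ∧ p.getLast? = some v ∧
      List.Chain' (fun a b => s(a, b) ∈ E) p

/-- `D` is the outermost boundary cycle `D_k` of the square of index `z` of the star
component `C(0)`: (a) the square lies in the interior of `D`; (b) every edge of `D` is a
boundary edge adjacent to an occupied square of `C(0)` in the interior of `D` and to a
vacant square in the exterior of `D`; (c) every cycle of `G_C` containing the square in
its interior has all its edges on `D` or in the interior of `D`. -/
def isOutermostCycleOf (ω : GridV → Prop) (z : GridV) (D : Set (Sym2 GridV)) : Prop :=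
  IsCycleIn (gcEdges ω) D ∧
  inInterior D (squareSet z) ∧
  (∀ e ∈ D,
    (∃ w ∈ starComp ω, e ∈ squareEdges w ∧ inInterior D (squareSet w)) ∧
    (∃ w, ¬ ω w ∧ e ∈ squareEdges w ∧ inExterior D (squareSet w))) ∧
  (∀ C, IsCycleIn (gcEdges ω) C → inInterior C (squareSet z) →
    ∀ e ∈ C, e ∈ D ∨ inInterior D (edgeSeg e))

/-- The list of edges traversed by a walk given as a list of vertices. -/
def walkEdges (p : List GridV) : List (Sym2 GridV) :=
  List.zipWith (fun a b => s(a, b)) p p.tail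

/-- The horizontal edge with left endpoint `(x, y)`. -/
def hEdge (x y : ℤ) : Sym2 GridV := s((x, y), (x + 1, y))

/-- The vertical edge with lower endpoint `(x, y)`. -/
def vEdge (x y : ℤ) : Sym2 GridV := s((x, y), (x, y + 1))

/-- The edges traversed by the first `N` steps of the sequence `F`. -/
def pathEdges (N : ℕ) (F : ℕ → GridV) : Set (Sym2 GridV) := {e | ∃ i < N, e = s(F i, F (i + 1))}

/-- The first `N` steps of `F` trace a cycle of the grid. -/
structure IsLoop (N : ℕ) (F : ℕ → GridV) : Prop where
  three_le : 3 ≤ N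
  injOn : Set.InjOn F (Set.Iio N)
  closed : F N = F 0
  adj : ∀ i < N, GridAdj (F i) (F (i + 1))

theorem GridAdj.symm {u v : GridV} (h : GridAdj u v) : GridAdj v u := by
  unfold GridAdj at *
  rwa [abs_sub_comm, abs_sub_comm v.2]

theorem GridAdj.cases {u v : GridV} (h : GridAdj u v) :
    v = (u.1 + 1, u.2) ∨ v = (u.1 - 1, u.2) ∨ v = (u.1, u.2 + 1) ∨ v = (u.1, u.2 - 1) := by
  obtain ⟨a, b⟩ := u
  obtain ⟨c, d⟩ := v
  simp only [GridAdj, Prod.mk.injEq] at *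
  rcases abs_cases (a - c) with h1 | h1 <;> rcases abs_cases (b - d) with h2 | h2 <;> omega

theorem GridAdj.eq_hEdge_or_vEdge {u v : GridV} (h : GridAdj u v) :
    (∃ x y, s(u, v) = hEdge x y) ∨ ∃ x y, s(u, v) = vEdge x y := by
  obtain ⟨a, b⟩ := u
  rcases h.cases with rfl | rfl | rfl | rfl
  · exact .inl ⟨a, b, rfl⟩
  · exact .inl ⟨a - 1, b, by simp [hEdge, Sym2.eq_swap]⟩
  · exact .inr ⟨a, b, rfl⟩
  · exact .inr ⟨a, b - 1, by simp [vEdge, Sym2.eq_swap]⟩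

theorem IsLoop.isCycle {N : ℕ} {F : ℕ → GridV} (h : IsLoop N F) : IsCycle (pathEdges N F) := by
  have hN := h.three_le
  have : NeZero N := ⟨by omega⟩
  have key : ∀ i : ZMod N, F (i + 1).val = F (i.val + 1) := by
    intro i
    have hi := ZMod.val_lt i
    have : Fact (1 < N) := ⟨by omega⟩
    rw [ZMod.val_add, ZMod.val_one]
    rcases Nat.lt_or_ge (i.val + 1) N with h1 | h1
    · rw [Nat.mod_eq_of_lt h1]
    · have : i.val + 1 = N := by omega
      rw [this, Nat.mod_self, h.closed]
  refine ⟨⟨N, hN, fun i => F i.val, ?_, ?_⟩, ?_⟩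
  · intro i j hij
    exact ZMod.val_injective N (h.injOn (ZMod.val_lt i) (ZMod.val_lt j) hij)
  · intro i
    simp only [key]
    exact h.adj _ (ZMod.val_lt i)
  · ext e
    simp only [GridCycle.edgeSet, pathEdges, Set.mem_ofPred_eq, key]
    constructor
    · rintro ⟨i, rfl⟩
      exact ⟨i.val, ZMod.val_lt i, rfl⟩
    · rintro ⟨i, hi, rfl⟩
      exact ⟨(i : ZMod N), by rw [ZMod.val_natCast, Nat.mod_eq_of_lt hi]⟩

theorem IsCycle.exists_isLoop {E : Set (Sym2 GridV)} (h : IsCycle E) {v : GridV}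
    (hv : v ∈ vertexSetOf E) : ∃ N F, IsLoop N F ∧ F 0 = v ∧ E = pathEdges N F := by
  obtain ⟨C, rfl⟩ := h
  have hn := C.hn
  have : NeZero C.n := ⟨by omega⟩
  obtain ⟨i0, hi0⟩ : ∃ i, C.f i = v := by
    obtain ⟨e, ⟨i, rfl⟩, hv⟩ := hv
    rcases Sym2.mem_iff.1 hv with h | h
    exacts [⟨_, h.symm⟩, ⟨_, h.symm⟩]
  refine ⟨C.n, fun k => C.f (i0 + k), ⟨hn, ?_, by simp, ?_⟩, by simpa using hi0, ?_⟩
  · intro k hk l hl hkl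
    have := add_left_cancel (C.inj hkl)
    rw [ZMod.natCast_eq_natCast_iff', Nat.mod_eq_of_lt hk, Nat.mod_eq_of_lt hl] at this
    exact this
  · intro i _
    have := C.adj (i0 + i)
    rwa [add_assoc, ← Nat.cast_succ] at this
  · ext e
    simp only [GridCycle.edgeSet, pathEdges, Set.mem_ofPred_eq]
    constructor
    · rintro ⟨i, rfl⟩
      refine ⟨(i - i0).val, ZMod.val_lt _, ?_⟩
      simp [← add_assoc]
    · rintro ⟨i, _, rfl⟩
      exact ⟨i0 + i, by simp [add_assoc]⟩

theorem IsLoop.mem_vertexSetOf_iff {N : ℕ} {F : ℕ → GridV} (h : IsLoop N F) {v : GridV} :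
    v ∈ vertexSetOf (pathEdges N F) ↔ ∃ i < N, v = F i := by
  have hN := h.three_le
  constructor
  · rintro ⟨e, ⟨i, hi, rfl⟩, hv⟩
    rcases Sym2.mem_iff.1 hv with rfl | rfl
    · exact ⟨i, hi, rfl⟩
    · rcases Nat.lt_or_ge (i + 1) N with h1 | h1
      · exact ⟨_, h1, rfl⟩
      · have : i + 1 = N := by omega
        exact ⟨0, by omega, by rw [this, h.closed]⟩
  · rintro ⟨i, hi, rfl⟩
    exact ⟨_, ⟨i, hi, rfl⟩, Sym2.mem_mk_left _ _⟩

theorem IsLoop.eq_or_of_eq {N : ℕ} {F : ℕ → GridV} (h : IsLoop N F) {i j : ℕ} (hi : i ≤ N)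
    (hj : j ≤ N) (hij : F i = F j) : i = j ∨ (i = 0 ∧ j = N) ∨ (i = N ∧ j = 0) := by
  have hN := h.three_le
  rcases Nat.lt_or_ge i N with h1 | h1 <;> rcases Nat.lt_or_ge j N with h2 | h2
  · exact .inl (h.injOn h1 h2 hij)
  · obtain rfl : j = N := by omega
    rw [h.closed] at hij
    exact .inr (.inl ⟨h.injOn h1 (show 0 < j by omega) hij, rfl⟩)
  · obtain rfl : i = N := by omega
    rw [h.closed] at hij
    exact .inr (.inr ⟨rfl, h.injOn h2 (show 0 < i by omega) hij.symm⟩)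
  · omega

theorem IsLoop.edge_injective {N : ℕ} {F : ℕ → GridV} (h : IsLoop N F) {i j : ℕ} (hi : i < N)
    (hj : j < N) (hij : s(F i, F (i + 1)) = s(F j, F (j + 1))) : i = j := by
  have hN := h.three_le
  rcases Sym2.eq_iff.1 hij with ⟨h1, -⟩ | ⟨h1, h2⟩
  · exact h.injOn hi hj h1
  · have := h.eq_or_of_eq hi.le (show j + 1 ≤ N by omega) h1
    have := h.eq_or_of_eq (show i + 1 ≤ N by omega) hj.le h2
    omega

theorem IsCycle.exists_two_neighbors {E : Set (Sym2 GridV)} (h : IsCycle E) {v : GridV}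
    (hv : v ∈ vertexSetOf E) :
    ∃ a b, a ≠ b ∧ GridAdj v a ∧ GridAdj v b ∧ ∀ w, s(v, w) ∈ E ↔ w = a ∨ w = b := by
  obtain ⟨N, F, hF, rfl, rfl⟩ := h.exists_isLoop hv
  have hN := hF.three_le
  have hlast : F (N - 1 + 1) = F 0 := by rw [Nat.sub_add_cancel (by omega), hF.closed]
  refine ⟨F 1, F (N - 1), ?_, hF.adj 0 (by omega), ?_, ?_⟩
  · intro h1
    have := hF.eq_or_of_eq (by omega) (by omega) h1
    omega
  · have := hF.adj (N - 1) (by omega)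
    rw [hlast] at this
    exact this.symm
  · intro w
    constructor
    · rintro ⟨i, hi, h1⟩
      rcases Sym2.eq_iff.1 h1 with ⟨h1, h2⟩ | ⟨h1, h2⟩
      · have := hF.eq_or_of_eq (by omega) (by omega) h1
        obtain rfl : i = 0 := by omega
        exact .inl h2
      · have := hF.eq_or_of_eq (by omega) (by omega) h1
        obtain rfl : i = N - 1 := by omega
        exact .inr h2
    · rintro (rfl | rfl)
      · exact ⟨0, by omega, rfl⟩
      · exact ⟨N - 1, by omega, by rw [hlast, Sym2.eq_swap]⟩

theorem IsCycle.gridAdj {E : Set (Sym2 GridV)} (h : IsCycle E) {u v : GridV} (he : s(u, v) ∈ E) :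
    GridAdj u v := by
  obtain ⟨C, rfl⟩ := h
  obtain ⟨i, hi⟩ := he
  rcases Sym2.eq_iff.1 hi with ⟨rfl, rfl⟩ | ⟨rfl, rfl⟩
  exacts [C.adj i, (C.adj i).symm]

/-- Two paths with the same endpoints and no other common vertex form a cycle. -/
theorem isCycle_union_pathEdges {s r : ℕ} {p q : ℕ → GridV} (hs : 1 ≤ s) (hr : 1 ≤ r)
    (hsr : 3 ≤ s + r) (h0 : p 0 = q 0) (h1 : p s = q r) (hp : Set.InjOn p (Set.Iic s))
    (hq : Set.InjOn q (Set.Iic r)) (hpq : ∀ i ≤ s, ∀ j, 0 < j → j < r → p i ≠ q j)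
    (hpa : ∀ i < s, GridAdj (p i) (p (i + 1))) (hqa : ∀ i < r, GridAdj (q i) (q (i + 1))) :
    IsCycle (pathEdges s p ∪ pathEdges r q) := by
  set F : ℕ → GridV := fun k => if k ≤ s then p k else q (s + r - k) with hF
  have hFp : ∀ k ≤ s, F k = p k := fun k hk => if_pos hk
  have hFq : ∀ k, s ≤ k → F k = q (s + r - k) := by
    intro k hk
    rcases hk.eq_or_lt with rfl | hk
    · simp [hF, h1]
    · exact if_neg (by omega)
  have hloop : IsLoop (s + r) F := by
    refine ⟨hsr, ?_, ?_, ?_⟩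
    · intro i hi j hj hij
      simp only [Set.mem_Iio] at hi hj
      rcases le_or_gt i s with h2 | h2 <;> rcases le_or_gt j s with h3 | h3
      · rw [hFp i h2, hFp j h3] at hij
        exact hp h2 h3 hij
      · rw [hFp i h2, hFq j h3.le] at hij
        exact absurd hij (hpq _ h2 _ (by omega) (by omega))
      · rw [hFp j h3, hFq i h2.le] at hij
        exact absurd hij.symm (hpq _ h3 _ (by omega) (by omega))
      · rw [hFq i h2.le, hFq j h3.le] at hij
        have := hq (show s + r - i ≤ r by omega) (show s + r - j ≤ r by omega) hij
        omega
    · rw [hFq _ (by omega), hFp 0 (by omega), h0, Nat.sub_self]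
    · intro i hi
      rcases Nat.lt_or_ge i s with h2 | h2
      · rw [hFp i h2.le, hFp (i + 1) h2]
        exact hpa i h2
      · rw [hFq i h2, hFq (i + 1) (by omega)]
        have := hqa (s + r - (i + 1)) (by omega)
        rw [show s + r - (i + 1) + 1 = s + r - i by omega] at this
        exact this.symm
  convert hloop.isCycle using 1
  ext e
  constructor
  · rintro (⟨i, hi, rfl⟩ | ⟨i, hi, rfl⟩)
    · exact ⟨i, by omega, by rw [hFp i hi.le, hFp (i + 1) hi]⟩
    · refine ⟨s + r - (i + 1), by omega, ?_⟩
      rw [hFq _ (by omega), hFq _ (by omega), Sym2.eq_swap,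
        show s + r - (s + r - (i + 1)) = i + 1 by omega,
        show s + r - (s + r - (i + 1) + 1) = i by omega]
  · rintro ⟨i, hi, rfl⟩
    rcases Nat.lt_or_ge i s with h2 | h2
    · exact .inl ⟨i, h2, by rw [hFp i h2.le, hFp (i + 1) h2]⟩
    · refine .inr ⟨s + r - (i + 1), by omega, ?_⟩
      rw [hFq i h2, hFq (i + 1) (by omega), Sym2.eq_swap,
        show s + r - (i + 1) + 1 = s + r - i by omega]

theorem IsLoop.exists_ear {N : ℕ} {F : ℕ → GridV} (hF : IsLoop N F) {V : Set GridV} (h0 : F 0 ∈ V)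
    {k : ℕ} (hk : k < N) (hk0 : 0 < k) (hkV : F k ∈ V) {c : ℕ} (hc : c < N) :
    ∃ a b, a ≤ c ∧ c < b ∧ b ≤ N ∧ F a ∈ V ∧ F b ∈ V ∧ (∀ i, a < i → i < b → F i ∉ V) ∧
      Set.InjOn F (Set.Icc a b) := by
  classical
  have hb : ∃ b, c < b ∧ F b ∈ V := ⟨N, hc, by rwa [hF.closed]⟩
  have hb1 := Nat.find_spec hb
  have hb2 : ∀ m, c < m → F m ∈ V → Nat.find hb ≤ m := fun m h1 h2 => Nat.find_min' hb ⟨h1, h2⟩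
  set b := Nat.find hb
  set a := Nat.findGreatest (fun i => F i ∈ V) c with ha
  have ha1 : a ≤ c := Nat.findGreatest_le c
  have ha2 : F a ∈ V := Nat.findGreatest_spec (P := fun i => F i ∈ V) (Nat.zero_le c) h0
  have ha3 : ∀ m, m ≤ c → F m ∈ V → m ≤ a := fun m h1 h2 =>
    Nat.le_findGreatest (P := fun i => F i ∈ V) h1 h2
  have hbN : b ≤ N := hb2 N hc (by rwa [hF.closed])
  refine ⟨a, b, ha1, hb1.1, hbN, ha2, hb1.2, ?_, ?_⟩
  · intro i h1 h2 h3
    rcases le_or_gt i c with h4 | h4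
    · have := ha3 i h4 h3
      omega
    · have := hb2 i h4 h3
      omega
  · intro i hi j hj hij
    simp only [Set.mem_Icc] at hi hj
    have h1 := hF.eq_or_of_eq (by omega) (by omega) hij
    have h2 : k ≤ a ∨ b ≤ k := by
      rcases le_or_gt k c with h4 | h4
      exacts [.inl (ha3 k h4 hkV), .inr (hb2 k h4 hkV)]
    omega

/-- If two cycles share two vertices, every edge of the second which is not on the first lies on
two cycles whose sum modulo two is the first cycle. -/
theorem exists_theta {D D' : Set (Sym2 GridV)} (hD : IsCycle D) (hD' : IsCycle D')
    {x y : GridV} (hxy : x ≠ y) (hx : x ∈ vertexSetOf D) (hx' : x ∈ vertexSetOf D')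
    (hy : y ∈ vertexSetOf D) (hy' : y ∈ vertexSetOf D') {e : Sym2 GridV} (he' : e ∈ D')
    (he : e ∉ D) :
    ∃ C₁ C₂, IsCycle C₁ ∧ IsCycle C₂ ∧ C₁ ⊆ D ∪ D' ∧ C₂ ⊆ D ∪ D' ∧ e ∈ C₁ ∧ e ∈ C₂ ∧
      ∀ f, f ∈ D ↔ ¬ (f ∈ C₁ ↔ f ∈ C₂) := by
  obtain ⟨N, F, hF, rfl, rfl⟩ := hD'.exists_isLoop hx'
  obtain ⟨k, hk, rfl⟩ := hF.mem_vertexSetOf_iff.1 hy'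
  obtain ⟨c, hc, rfl⟩ := he'
  have hk0 : 0 < k := Nat.pos_of_ne_zero fun h => hxy (by rw [h])
  obtain ⟨a, b, hac, hcb, hbN, haV, hbV, hV, hinj⟩ := hF.exists_ear hx hk hk0 hy hc
  obtain ⟨n, H, hH, hHa, rfl⟩ := hD.exists_isLoop haV
  obtain ⟨t, ht, hHb⟩ := hH.mem_vertexSetOf_iff.1 hbV
  have ht0 : 0 < t := by
    refine Nat.pos_of_ne_zero fun h => ?_
    subst h
    have := hinj (show a ∈ Set.Icc a b by simp; omega) (show b ∈ Set.Icc a b by simp; omega)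
      (by rw [hHb, hHa])
    omega
  have hQV : ∀ j, 0 < j → j < b - a → F (a + j) ∉ vertexSetOf (pathEdges n H) :=
    fun j h1 h2 => hV _ (by omega) (by omega)
  have hHV : ∀ i ≤ n, H i ∈ vertexSetOf (pathEdges n H) := by
    intro i hi
    rw [hH.mem_vertexSetOf_iff]
    rcases hi.eq_or_lt with rfl | h
    · exact ⟨0, by omega, hH.closed⟩
    · exact ⟨i, h, rfl⟩
  have hQD : ∀ f ∈ pathEdges (b - a) (fun j => F (a + j)), f ∉ pathEdges n H := by
    rintro f ⟨j, hj, rfl⟩ hf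
    have h1 := hQV j
    have h2 := hQV (j + 1)
    have h3 : F (a + j) ∈ vertexSetOf (pathEdges n H) := ⟨_, hf, Sym2.mem_mk_left _ _⟩
    have h4 : F (a + (j + 1)) ∈ vertexSetOf (pathEdges n H) := ⟨_, hf, Sym2.mem_mk_right _ _⟩
    have h5 : ¬ (0 < j ∧ j < b - a) := fun h => h1 h.1 h.2 h3
    have h6 : ¬ (0 < j + 1 ∧ j + 1 < b - a) := fun h => h2 h.1 h.2 h4
    have h7 : a + j = c := by omega
    simp only [← add_assoc, h7] at hf
    exact he hf
  have hQinj : Set.InjOn (fun j => F (a + j)) (Set.Iic (b - a)) := by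
    intro i hi j hj hij
    simp only [Set.mem_Iic] at hi hj
    have := hinj (show a + i ∈ Set.Icc a b by simp; omega)
      (show a + j ∈ Set.Icc a b by simp; omega) hij
    omega
  have hQadj : ∀ i < b - a, GridAdj (F (a + i)) (F (a + (i + 1))) := fun i hi =>
    hF.adj (a + i) (by omega)
  have hlen : ∀ u v, b - a = 1 → s(H u, H v) ∈ pathEdges n H → H u = F a → H v = F b → False := by
    intro u v h1 h2 h3 h4
    obtain rfl : a = c := by omega
    obtain rfl : b = a + 1 := by omega
    rw [h3, h4] at h2
    exact he h2
  have hmem : s(F c, F (c + 1)) ∈ pathEdges (b - a) (fun j => F (a + j)) :=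
    ⟨c - a, by omega, by simp only [← add_assoc, Nat.add_sub_cancel' hac]⟩
  have hQsub : pathEdges (b - a) (fun j => F (a + j)) ⊆ pathEdges N F := by
    rintro _ ⟨j, hj, rfl⟩
    exact ⟨a + j, by omega, rfl⟩
  have hA : pathEdges t H ⊆ pathEdges n H := by
    rintro _ ⟨j, hj, rfl⟩
    exact ⟨j, by omega, rfl⟩
  have hB : ∀ f, f ∈ pathEdges (n - t) (fun i => H (n - i)) ↔
      ∃ i, t ≤ i ∧ i < n ∧ f = s(H i, H (i + 1)) := by
    intro f
    constructor
    · rintro ⟨j, hj, rfl⟩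
      refine ⟨n - (j + 1), by omega, by omega, ?_⟩
      rw [Sym2.eq_swap, show n - (j + 1) + 1 = n - j by omega]
    · rintro ⟨i, h1, h2, rfl⟩
      refine ⟨n - (i + 1), by omega, ?_⟩
      simp only
      rw [Sym2.eq_swap, show n - (n - (i + 1)) = i + 1 by omega,
        show n - (n - (i + 1) + 1) = i by omega]
  have hBsub : pathEdges (n - t) (fun i => H (n - i)) ⊆ pathEdges n H := by
    intro f hf
    obtain ⟨i, -, h2, rfl⟩ := (hB f).1 hf
    exact ⟨i, h2, rfl⟩
  refine ⟨pathEdges t H ∪ pathEdges (b - a) (fun j => F (a + j)),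
    pathEdges (n - t) (fun i => H (n - i)) ∪ pathEdges (b - a) (fun j => F (a + j)), ?_, ?_,
    Set.union_subset_union hA hQsub, Set.union_subset_union hBsub hQsub, .inr hmem, .inr hmem, ?_⟩
  · refine isCycle_union_pathEdges ht0 (by omega) ?_ (by simpa using hHa) ?_ ?_ hQinj ?_
      (fun i hi => hH.adj i (by omega)) hQadj
    · by_contra h
      obtain rfl : t = 1 := by omega
      exact hlen 0 1 (by omega) ⟨0, by omega, rfl⟩ hHa hHb.symm
    · rw [← hHb, Nat.add_sub_cancel' (by omega)]
    · intro i hi j hj hij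
      simp only [Set.mem_Iic] at hi hj
      have := hH.eq_or_of_eq (by omega) (by omega) hij
      omega
    · intro i hi j h1 h2 h3
      exact hQV j h1 h2 (h3 ▸ hHV i (by omega))
  · refine isCycle_union_pathEdges (by omega) (by omega) ?_ (by simpa [hH.closed] using hHa) ?_ ?_
      hQinj ?_ ?_ hQadj
    · by_contra h
      obtain rfl : n = t + 1 := by omega
      refine hlen (t + 1) t (by omega) ⟨t, by omega, Sym2.eq_swap⟩ ?_ hHb.symm
      rw [hH.closed, hHa]
    · rw [Nat.sub_sub_self (by omega), Nat.add_sub_cancel' (by omega), hHb]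
    · intro i hi j hj hij
      simp only [Set.mem_Iic] at hi hj
      have := hH.eq_or_of_eq (by omega) (by omega) hij
      omega
    · intro i hi j h1 h2 h3
      exact hQV j h1 h2 (h3 ▸ hHV (n - i) (by omega))
    · intro i hi
      have := hH.adj (n - (i + 1)) (by omega)
      rw [show n - (i + 1) + 1 = n - i by omega] at this
      exact this.symm
  · intro f
    have hdisj : f ∈ pathEdges t H → f ∉ pathEdges (n - t) (fun i => H (n - i)) := by
      rintro ⟨i, hi, rfl⟩ hf
      obtain ⟨j, h1, h2, h3⟩ := (hB _).1 hf
      have := hH.edge_injective (by omega) h2 h3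
      omega
    have hcover : f ∈ pathEdges n H → f ∈ pathEdges t H ∨
        f ∈ pathEdges (n - t) (fun i => H (n - i)) := by
      rintro ⟨i, hi, rfl⟩
      rcases Nat.lt_or_ge i t with h1 | h1
      exacts [.inl ⟨i, h1, rfl⟩, .inr ((hB _).2 ⟨i, h1, hi, rfl⟩)]
    have h1 := hQD f
    have h2 := @hA f
    have h3 := @hBsub f
    simp only [Set.mem_union]
    tauto

theorem mem_edgeSeg_hEdge {x y : ℤ} {p : ℝ × ℝ} :
    p ∈ edgeSeg (hEdge x y) ↔
      (x : ℝ) - 1 / 2 ≤ p.1 ∧ p.1 ≤ (x : ℝ) + 1 / 2 ∧ p.2 = (y : ℝ) - 1 / 2 := by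
  obtain ⟨s, t⟩ := p
  simp only [edgeSeg, hEdge, Sym2.lift_mk, segment, toPlane, Set.mem_ofPred_eq]
  constructor
  · rintro ⟨a, b, ha, hb, hab, h⟩
    obtain rfl : a = 1 - b := by linarith
    simp only [Prod.ext_iff, Prod.fst_add, Prod.snd_add, Prod.smul_fst, Prod.smul_snd,
      smul_eq_mul, Int.cast_add, Int.cast_one] at h
    exact ⟨by linarith, by linarith, by linarith⟩
  · rintro ⟨h1, h2, h3⟩
    refine ⟨1 - (s - (x - 1 / 2)), s - (x - 1 / 2), by linarith, by linarith, by ring, ?_⟩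
    simp only [Prod.ext_iff, Prod.fst_add, Prod.snd_add, Prod.smul_fst, Prod.smul_snd,
      smul_eq_mul, Int.cast_add, Int.cast_one]
    exact ⟨by ring, by rw [h3]; ring⟩

theorem mem_edgeSeg_vEdge {x y : ℤ} {p : ℝ × ℝ} :
    p ∈ edgeSeg (vEdge x y) ↔
      p.1 = (x : ℝ) - 1 / 2 ∧ (y : ℝ) - 1 / 2 ≤ p.2 ∧ p.2 ≤ (y : ℝ) + 1 / 2 := by
  obtain ⟨s, t⟩ := p
  simp only [edgeSeg, vEdge, Sym2.lift_mk, segment, toPlane, Set.mem_ofPred_eq]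
  constructor
  · rintro ⟨a, b, ha, hb, hab, h⟩
    obtain rfl : a = 1 - b := by linarith
    simp only [Prod.ext_iff, Prod.fst_add, Prod.snd_add, Prod.smul_fst, Prod.smul_snd,
      smul_eq_mul, Int.cast_add, Int.cast_one] at h
    exact ⟨by linarith, by linarith, by linarith⟩
  · rintro ⟨h1, h2, h3⟩
    refine ⟨1 - (t - (y - 1 / 2)), t - (y - 1 / 2), by linarith, by linarith, by ring, ?_⟩
    simp only [Prod.ext_iff, Prod.fst_add, Prod.snd_add, Prod.smul_fst, Prod.smul_snd,
      smul_eq_mul, Int.cast_add, Int.cast_one]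
    exact ⟨by rw [h1]; ring, by ring⟩

theorem mem_squareSet {x y : ℤ} {p : ℝ × ℝ} :
    p ∈ squareSet (x, y) ↔ ((x : ℝ) - 1 / 2 ≤ p.1 ∧ p.1 ≤ (x : ℝ) + 1 / 2) ∧
      (y : ℝ) - 1 / 2 ≤ p.2 ∧ p.2 ≤ (y : ℝ) + 1 / 2 := by
  simp only [squareSet, Set.mem_Icc, Prod.le_def]
  tauto

theorem mem_carrierOf {E : Set (Sym2 GridV)} {p : ℝ × ℝ} :
    p ∈ carrierOf E ↔ ∃ e ∈ E, p ∈ edgeSeg e := by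
  simp [carrierOf]

theorem int_ne_add_half {x y : ℤ} : (x : ℝ) ≠ (y : ℝ) - 1 / 2 := by
  intro h
  have : (2 * x : ℝ) = 2 * y - 1 := by linarith
  have : 2 * x = 2 * y - 1 := by exact_mod_cast this
  omega

theorem int_eq_of_half_le {x i : ℤ} (h1 : (i : ℝ) - 1 / 2 ≤ x) (h2 : (x : ℝ) ≤ i + 1 / 2) :
    i = x := by
  have h3 : (2 * i - 1 : ℝ) ≤ 2 * x := by linarith
  have h4 : (2 * x : ℝ) ≤ 2 * i + 1 := by linarith
  have h3 : 2 * i - 1 ≤ 2 * x := by exact_mod_cast h3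
  have h4 : 2 * x ≤ 2 * i + 1 := by exact_mod_cast h4
  omega

/-- A cycle meets the vertical line through the centres of a column of squares only at midpoints
of its horizontal edges. -/
theorem IsCycle.exists_hEdge_mem {E : Set (Sym2 GridV)} (hE : IsCycle E) {x : ℤ} {t : ℝ}
    (h : ((x : ℝ), t) ∈ carrierOf E) : ∃ j : ℤ, t = (j : ℝ) - 1 / 2 ∧ hEdge x j ∈ E := by
  obtain ⟨e, he, hp⟩ := mem_carrierOf.1 h
  induction e with | _ u v
  rcases (hE.gridAdj he).eq_hEdge_or_vEdge with ⟨i, j, h1⟩ | ⟨i, j, h1⟩ <;> rw [h1] at he hp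
  · obtain ⟨h2, h3, h4⟩ := mem_edgeSeg_hEdge.1 hp
    obtain rfl := int_eq_of_half_le h2 h3
    exact ⟨j, h4, he⟩
  · exact absurd (mem_edgeSeg_vEdge.1 hp).1 int_ne_add_half

/-- A cycle meets the horizontal line through the centres of a row of squares only at midpoints
of its vertical edges. -/
theorem IsCycle.exists_vEdge_mem {E : Set (Sym2 GridV)} (hE : IsCycle E) {y : ℤ} {t : ℝ}
    (h : (t, (y : ℝ)) ∈ carrierOf E) : ∃ i : ℤ, t = (i : ℝ) - 1 / 2 ∧ vEdge i y ∈ E := by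
  obtain ⟨e, he, hp⟩ := mem_carrierOf.1 h
  induction e with | _ u v
  rcases (hE.gridAdj he).eq_hEdge_or_vEdge with ⟨i, j, h1⟩ | ⟨i, j, h1⟩ <;> rw [h1] at he hp
  · exact absurd (mem_edgeSeg_hEdge.1 hp).2.2 int_ne_add_half
  · obtain ⟨h2, h3, h4⟩ := mem_edgeSeg_vEdge.1 hp
    obtain rfl := int_eq_of_half_le h3 h4
    exact ⟨i, h2, he⟩

/-- The centre of a square. -/
def squareCenter (z : GridV) : ℝ × ℝ := (z.1, z.2)

theorem squareCenter_mem_squareSet (z : GridV) : squareCenter z ∈ squareSet z := by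
  rw [mem_squareSet]
  simp only [squareCenter]
  exact ⟨⟨by linarith, by linarith⟩, by linarith, by linarith⟩

theorem IsCycle.squareCenter_notMem {E : Set (Sym2 GridV)} (hE : IsCycle E) (z : GridV) :
    squareCenter z ∉ carrierOf E := fun h => by
  obtain ⟨j, h1, -⟩ := hE.exists_hEdge_mem h
  exact int_ne_add_half h1

theorem hEdge_mem_squareEdges {x y : ℤ} {w : GridV} :
    hEdge x y ∈ squareEdges w ↔ w = (x, y) ∨ w = (x, y - 1) := by
  obtain ⟨a, b⟩ := w
  simp only [hEdge, squareEdges, Set.mem_insert_iff, Set.mem_singleton_iff, Sym2.eq_iff,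
    Prod.mk_add_mk, Prod.mk.injEq]
  omega

theorem vEdge_mem_squareEdges {x y : ℤ} {w : GridV} :
    vEdge x y ∈ squareEdges w ↔ w = (x, y) ∨ w = (x - 1, y) := by
  obtain ⟨a, b⟩ := w
  simp only [vEdge, squareEdges, Set.mem_insert_iff, Set.mem_singleton_iff, Sym2.eq_iff,
    Prod.mk_add_mk, Prod.mk.injEq]
  omega

/-- All endpoints of edges of `E` have coordinates of absolute value less than `M`. -/
def EdgeBound (E : Set (Sym2 GridV)) (M : ℤ) : Prop :=
  ∀ e ∈ E, ∀ v ∈ e, |v.1| < M ∧ |v.2| < M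

theorem IsCycle.exists_edgeBound {E : Set (Sym2 GridV)} (hE : IsCycle E) :
    ∃ M, ∀ M' ≥ M, EdgeBound E M' := by
  obtain ⟨C, rfl⟩ := hE
  have : NeZero C.n := ⟨by have := C.hn; omega⟩
  obtain ⟨M, hM⟩ := (Set.finite_range fun i => max |(C.f i).1| |(C.f i).2|).bddAbove
  refine ⟨M + 1, ?_⟩
  rintro M' hM' e ⟨i, rfl⟩ v hv
  obtain ⟨k, rfl⟩ : ∃ k, v = C.f k := by
    rcases Sym2.mem_iff.1 hv with h | h
    exacts [⟨_, h⟩, ⟨_, h⟩]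
  have := max_le_iff.1 (hM (Set.mem_range_self k))
  omega

theorem EdgeBound.hEdge {E : Set (Sym2 GridV)} {M x y : ℤ} (h : EdgeBound E M)
    (he : hEdge x y ∈ E) : |x| < M ∧ |y| < M :=
  h _ he (x, y) (Sym2.mem_mk_left _ _)

theorem EdgeBound.vEdge {E : Set (Sym2 GridV)} {M x y : ℤ} (h : EdgeBound E M)
    (he : vEdge x y ∈ E) : |x| < M ∧ |y| < M :=
  h _ he (x, y) (Sym2.mem_mk_left _ _)

open Classical in
/-- The indicator of an edge set modulo two. -/
noncomputable def edgeInd (E : Set (Sym2 GridV)) (e : Sym2 GridV) : ZMod 2 := if e ∈ E then 1 else 0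

/-- The parity of the number of edges of `E`, of height at most `M`, above a square. -/
noncomputable def crossParity (E : Set (Sym2 GridV)) (M x y : ℤ) : ZMod 2 :=
  ∑ j ∈ Finset.Ioc y M, edgeInd E (hEdge x j)

theorem edgeInd_of_mem {E : Set (Sym2 GridV)} {e : Sym2 GridV} (h : e ∈ E) : edgeInd E e = 1 :=
  if_pos h

theorem edgeInd_of_notMem {E : Set (Sym2 GridV)} {e : Sym2 GridV} (h : e ∉ E) : edgeInd E e = 0 :=
  if_neg h

theorem edgeInd_ne_zero {E : Set (Sym2 GridV)} {e : Sym2 GridV} (h : edgeInd E e ≠ 0) : e ∈ E := by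
  by_contra h1
  exact h (edgeInd_of_notMem h1)

theorem zmod_two_eq_one_of_ne_zero {a : ZMod 2} (h : a ≠ 0) : a = 1 := by
  revert a; decide

theorem IsCycle.sum_edgeInd {E : Set (Sym2 GridV)} (hE : IsCycle E) (x y : ℤ) :
    edgeInd E (hEdge (x - 1) y) + edgeInd E (hEdge x y) + edgeInd E (vEdge x (y - 1)) +
      edgeInd E (vEdge x y) = 0 := by
  have h1 : hEdge (x - 1) y = s((x, y), (x - 1, y)) := by simp [hEdge, Sym2.eq_swap]
  have h2 : vEdge x (y - 1) = s((x, y), (x, y - 1)) := by simp [vEdge, Sym2.eq_swap]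
  rw [h1, h2, hEdge, vEdge]
  by_cases hv : (x, y) ∈ vertexSetOf E
  · obtain ⟨a, b, hab, ha, hb, h⟩ := hE.exists_two_neighbors hv
    simp only [edgeInd, h]
    rcases ha.cases with rfl | rfl | rfl | rfl <;> rcases hb.cases with rfl | rfl | rfl | rfl <;>
      simp at hab <;> simp [show ∀ a : ℤ, a ≠ a - 1 by intro a; omega,
        show ∀ a : ℤ, a - 1 ≠ a + 1 by intro a; omega,
        show ∀ a : ℤ, a + 1 ≠ a - 1 by intro a; omega] <;> decide
  · have : ∀ w, s((x, y), w) ∉ E := fun w hw => hv ⟨_, hw, Sym2.mem_mk_left _ _⟩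
    simp [edgeInd, this]

theorem crossParity_of_le {E : Set (Sym2 GridV)} {M x y : ℤ} (h : M ≤ y) :
    crossParity E M x y = 0 := by
  simp [crossParity, Finset.Ioc_eq_empty_of_le h]

theorem crossParity_sub_one {E : Set (Sym2 GridV)} {M : ℤ} (hM : EdgeBound E M) (x y : ℤ) :
    crossParity E M x (y - 1) = crossParity E M x y + edgeInd E (hEdge x y) := by
  rcases le_or_gt y M with h | h
  · have : Finset.Ioc (y - 1) M = insert y (Finset.Ioc y M) := by
      ext j
      simp only [Finset.mem_Ioc, Finset.mem_insert]
      omega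
    rw [crossParity, this, Finset.sum_insert (by simp), add_comm, crossParity]
  · rw [crossParity_of_le (by omega), crossParity_of_le (by omega), edgeInd_of_notMem, add_zero]
    intro he
    have := le_abs_self y
    have := (hM.hEdge he).2
    omega

theorem IsCycle.crossParity_add {E : Set (Sym2 GridV)} (hE : IsCycle E) {M : ℤ}
    (hM : EdgeBound E M) (x y : ℤ) :
    crossParity E M (x - 1) y + crossParity E M x y = edgeInd E (vEdge x y) := by
  rcases le_total M y with h | h
  · rw [crossParity_of_le h, crossParity_of_le h, edgeInd_of_notMem, add_zero]
    intro he
    have := le_abs_self y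
    have := (hM.vEdge he).2
    omega
  · induction y, h using Int.leInductionDown with
    | base =>
      rw [crossParity_of_le le_rfl, crossParity_of_le le_rfl, edgeInd_of_notMem, add_zero]
      intro he
      have := le_abs_self M
      have := (hM.vEdge he).2
      omega
    | pred y _ ih =>
      rw [crossParity_sub_one hM, crossParity_sub_one hM]
      have := hE.sum_edgeInd x y
      rw [← ih] at this
      clear ih
      generalize edgeInd E (vEdge x (y - 1)) = a at *
      generalize edgeInd E (hEdge x y) = b at *
      generalize edgeInd E (hEdge (x - 1) y) = c at *
      generalize crossParity E M (x - 1) y = d at *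
      generalize crossParity E M x y = f at *
      revert a b c d f
      decide

theorem IsCycle.crossParity_bound {E : Set (Sym2 GridV)} (hE : IsCycle E) {M : ℤ}
    (hM : EdgeBound E M) {x y : ℤ} (h : crossParity E M x y ≠ 0) : |x| ≤ M ∧ |y| ≤ M := by
  obtain ⟨j, hj, h1⟩ := Finset.exists_ne_zero_of_sum_ne_zero h
  have h2 := hM.hEdge (edgeInd_ne_zero h1)
  refine ⟨h2.1.le, ?_⟩
  simp only [Finset.mem_Ioc] at hj
  by_contra h3
  have h4 : y < -M := by
    rcases abs_cases y with h5 | h5 <;> omega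
  have h5 : ∀ i : ℕ, crossParity E M (x + i) y ≠ 0 := by
    intro i
    induction i with
    | zero => simpa using h
    | succ i ih =>
      have h6 := hE.crossParity_add hM (x + i + 1) y
      rw [edgeInd_of_notMem, add_sub_cancel_right] at h6
      · push_cast
        rw [← add_assoc]
        intro h7
        rw [h7, add_zero] at h6
        exact ih h6
      · intro he
        have := (hM.vEdge he).2
        have := neg_abs_le y
        omega
  obtain ⟨k, _, h6⟩ := Finset.exists_ne_zero_of_sum_ne_zero (h5 (2 * M).toNat)
  have h7 := (hM.hEdge (edgeInd_ne_zero h6)).1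
  rcases abs_cases x with h8 | h8 <;> rcases abs_cases (x + (2 * M).toNat) with h9 | h9 <;> omega

theorem crossParity_eq_add {E₁ E₂ E : Set (Sym2 GridV)}
    (h : ∀ f, f ∈ E ↔ ¬ (f ∈ E₁ ↔ f ∈ E₂)) (M x y : ℤ) :
    crossParity E M x y = crossParity E₁ M x y + crossParity E₂ M x y := by
  simp only [crossParity, ← Finset.sum_add_distrib]
  refine Finset.sum_congr rfl fun j _ => ?_
  have := h (hEdge x j)
  by_cases h1 : hEdge x j ∈ E₁ <;> by_cases h2 : hEdge x j ∈ E₂ <;>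
    by_cases h3 : hEdge x j ∈ E <;> simp [h1, h2, h3, edgeInd] at this ⊢ <;> decide

theorem mem_carrierOf_of_vertical {E : Set (Sym2 GridV)} {M x y y' : ℤ} {p : ℝ × ℝ}
    (hM : EdgeBound E M) (h : crossParity E M x y ≠ crossParity E M x y')
    (hp : p ∈ squareSet (x, y)) (hp' : p ∈ squareSet (x, y')) : p ∈ carrierOf E := by
  wlog hlt : y < y' generalizing y y'
  · refine this h.symm hp' hp (lt_of_le_of_ne (not_lt.1 hlt) ?_)
    rintro rfl
    exact h rfl
  rw [mem_squareSet] at hp hp'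
  have h1 : (y' : ℝ) ≤ y + 1 := by linarith
  have h1 : y' ≤ y + 1 := by exact_mod_cast h1
  obtain rfl : y = y' - 1 := by omega
  rw [crossParity_sub_one hM] at h
  refine mem_carrierOf.2 ⟨hEdge x y', edgeInd_ne_zero fun h0 => h (by rw [h0, add_zero]), ?_⟩
  rw [mem_edgeSeg_hEdge]
  push_cast at hp
  exact ⟨hp.1.1, hp.1.2, by linarith⟩

theorem IsCycle.mem_carrierOf_of_horizontal {E : Set (Sym2 GridV)} (hE : IsCycle E)
    {M x x' y : ℤ} {p : ℝ × ℝ}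
    (hM : EdgeBound E M) (h : crossParity E M x y ≠ crossParity E M x' y)
    (hp : p ∈ squareSet (x, y)) (hp' : p ∈ squareSet (x', y)) : p ∈ carrierOf E := by
  wlog hlt : x < x' generalizing x x'
  · refine this h.symm hp' hp (lt_of_le_of_ne (not_lt.1 hlt) ?_)
    rintro rfl
    exact h rfl
  rw [mem_squareSet] at hp hp'
  have h1 : (x' : ℝ) ≤ x + 1 := by linarith
  have h1 : x' ≤ x + 1 := by exact_mod_cast h1
  obtain rfl : x = x' - 1 := by omega
  refine mem_carrierOf.2 ⟨vEdge x' y, edgeInd_ne_zero fun h0 => h ?_, ?_⟩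
  · have := hE.crossParity_add hM x' y
    rw [h0] at this
    generalize crossParity E M (x' - 1) y = a at *
    generalize crossParity E M x' y = b at *
    revert a b
    decide
  · rw [mem_edgeSeg_vEdge]
    push_cast at hp
    exact ⟨by linarith, hp.2.1, hp.2.2⟩

theorem IsCycle.mem_carrierOf_of_crossParity_ne {E : Set (Sym2 GridV)} (hE : IsCycle E)
    {M : ℤ} (hM : EdgeBound E M) {z w : GridV} {p : ℝ × ℝ}
    (h : crossParity E M z.1 z.2 ≠ crossParity E M w.1 w.2)
    (hp : p ∈ squareSet z) (hp' : p ∈ squareSet w) : p ∈ carrierOf E := by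
  have hu : p ∈ squareSet (z.1, w.2) :=
    mem_squareSet.2 ⟨(mem_squareSet.1 hp).1, (mem_squareSet.1 hp').2⟩
  by_cases h1 : crossParity E M z.1 z.2 = crossParity E M z.1 w.2
  · exact hE.mem_carrierOf_of_horizontal hM (h1 ▸ h) hu hp'
  · exact mem_carrierOf_of_vertical hM h1 hp hu

theorem isClosed_squareSet (z : GridV) : IsClosed (squareSet z) := isClosed_Icc

theorem locallyFinite_squareSet : LocallyFinite squareSet := by
  intro p
  refine ⟨Metric.ball p 1, Metric.ball_mem_nhds p one_pos, ?_⟩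
  refine (Set.finite_Icc ((⌊p.1⌋ - 2, ⌊p.2⌋ - 2) : ℤ × ℤ) (⌊p.1⌋ + 3, ⌊p.2⌋ + 3)).subset ?_
  rintro ⟨x, y⟩ ⟨q, hq, hqp⟩
  rw [mem_squareSet] at hq
  rw [Metric.mem_ball, Prod.dist_eq, max_lt_iff, Real.dist_eq, Real.dist_eq, abs_lt, abs_lt] at hqp
  have h1 := Int.floor_le p.1
  have h2 := Int.lt_floor_add_one p.1
  have h3 := Int.floor_le p.2
  have h4 := Int.lt_floor_add_one p.2
  simp only [Set.mem_Icc, Prod.mk_le_mk]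
  refine ⟨⟨?_, ?_⟩, ?_, ?_⟩ <;> rify <;> linarith

theorem exists_mem_squareSet (p : ℝ × ℝ) : ∃ z, p ∈ squareSet z := by
  refine ⟨(round p.1, round p.2), ?_⟩
  have h1 := abs_le.1 (abs_sub_round p.1)
  have h2 := abs_le.1 (abs_sub_round p.2)
  rw [mem_squareSet]
  exact ⟨⟨by linarith, by linarith⟩, by linarith, by linarith⟩

/-- A square of odd crossing parity is enclosed by the cycle. -/
theorem IsCycle.inInterior_of_crossParity_ne {E : Set (Sym2 GridV)} (hE : IsCycle E)
    {M : ℤ} (hM : EdgeBound E M) {z : GridV} (hz : crossParity E M z.1 z.2 ≠ 0) :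
    inInterior E (squareSet z) := by
  intro p hp
  by_cases hpE : p ∈ carrierOf E
  · exact .inr hpE
  refine .inl ⟨hpE, ?_⟩
  let S : Set GridV := {w | crossParity E M w.1 w.2 ≠ 0}
  let K : Set (ℝ × ℝ) := ⋃ w : S, squareSet w
  let L : Set (ℝ × ℝ) := ⋃ w : ↥Sᶜ, squareSet w
  have hK : IsClosed K :=
    (locallyFinite_squareSet.comp_injective Subtype.val_injective).isClosed_iUnion
      fun w => isClosed_squareSet _
  have hL : IsClosed L :=
    (locallyFinite_squareSet.comp_injective Subtype.val_injective).isClosed_iUnion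
      fun w => isClosed_squareSet _
  have hKL : K ∩ L ⊆ carrierOf E := by
    rintro q ⟨h1, h2⟩
    obtain ⟨⟨w, hw⟩, h1⟩ := Set.mem_iUnion.1 h1
    obtain ⟨⟨w', hw'⟩, h2⟩ := Set.mem_iUnion.1 h2
    refine hE.mem_carrierOf_of_crossParity_ne hM (fun h => ?_) h1 h2
    exact hw' (show crossParity E M w'.1 w'.2 ≠ 0 from h ▸ hw)
  have hcover : ∀ q, q ∈ K ∪ L := by
    intro q
    obtain ⟨w, hw⟩ := exists_mem_squareSet q
    by_cases h : w ∈ S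
    · exact .inl (Set.mem_iUnion.2 ⟨⟨w, h⟩, hw⟩)
    · exact .inr (Set.mem_iUnion.2 ⟨⟨w, h⟩, hw⟩)
  have hSfin : S.Finite := by
    refine (Set.finite_Icc ((-M, -M) : ℤ × ℤ) (M, M)).subset fun w hw => ?_
    have := hE.crossParity_bound hM hw
    rw [abs_le, abs_le] at this
    exact ⟨⟨this.1.1, this.2.1⟩, this.1.2, this.2.2⟩
  have hKb : Bornology.IsBounded K := by
    have := hSfin.to_subtype
    exact Bornology.isBounded_iUnion.2 fun w => Metric.isBounded_Icc _ _
  refine hKb.subset fun q hq => ?_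
  by_contra hqK
  have hqL : q ∈ L := (hcover q).resolve_left hqK
  have hpK : p ∈ K := Set.mem_iUnion.2 ⟨⟨z, hz⟩, hp⟩
  obtain ⟨r, hr, hr'⟩ := isPreconnected_closed_iff.1 isPreconnected_connectedComponentIn K L hK hL
    (fun q _ => hcover q) ⟨p, mem_connectedComponentIn hpE, hpK⟩ ⟨q, hq, hqL⟩
  exact connectedComponentIn_subset _ _ hr (hKL hr')

theorem mem_interiorOf_iff_of_isPreconnected {E : Set (Sym2 GridV)} {A : Set (ℝ × ℝ)}
    (hA : IsPreconnected A) (hAE : Disjoint A (carrierOf E)) {p q : ℝ × ℝ} (hp : p ∈ A)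
    (hq : q ∈ A) : p ∈ interiorOf E ↔ q ∈ interiorOf E := by
  have hsub : A ⊆ (carrierOf E)ᶜ := fun r hr h => Set.disjoint_left.1 hAE hr h
  have := connectedComponentIn_eq (hA.subset_connectedComponentIn hp hsub hq)
  have h1 := hsub hp
  have h2 := hsub hq
  simp only [interiorOf, Set.mem_ofPred_eq, this, Set.mem_compl_iff] at *
  tauto

theorem isPreconnected_vertical (x : ℝ) {I : Set ℝ} (hI : IsPreconnected I) :
    IsPreconnected ((fun t => (x, t)) '' I) := hI.image _ (by fun_prop)

theorem isPreconnected_horizontal (y : ℝ) {I : Set ℝ} (hI : IsPreconnected I) :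
    IsPreconnected ((fun t => (t, y)) '' I) := hI.image _ (by fun_prop)

/-- The two sides of every edge of `D` are separated by `D`. -/
def Separates (D : Set (Sym2 GridV)) : Prop :=
  ∀ e ∈ D, (∃ w, e ∈ squareEdges w ∧ inInterior D (squareSet w)) ∧
    ∃ w, e ∈ squareEdges w ∧ inExterior D (squareSet w)

theorem IsCycle.center_mem_interiorOf {E : Set (Sym2 GridV)} (hE : IsCycle E) {w : GridV}
    (h : inInterior E (squareSet w)) : squareCenter w ∈ interiorOf E :=
  (h (squareCenter_mem_squareSet w)).resolve_right (hE.squareCenter_notMem w)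

theorem IsCycle.center_mem_exteriorOf {E : Set (Sym2 GridV)} (hE : IsCycle E) {w : GridV}
    (h : inExterior E (squareSet w)) : squareCenter w ∈ exteriorOf E :=
  (h (squareCenter_mem_squareSet w)).resolve_right (hE.squareCenter_notMem w)

theorem mem_interiorOf_iff_crossParity {D : Set (Sym2 GridV)} (hD : IsCycle D)
    (hsep : Separates D) {M : ℤ} (hM : EdgeBound D M) (x y : ℤ) :
    squareCenter (x, y) ∈ interiorOf D ↔ crossParity D M x y = 1 := by
  have htop : ∀ y, M ≤ y → (squareCenter (x, y) ∈ interiorOf D ↔ crossParity D M x y = 1) := by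
    intro y hy
    simp only [crossParity_of_le hy, zero_ne_one, iff_false]
    rintro ⟨-, hb⟩
    have hsub : (fun t : ℝ => ((x : ℝ), t)) '' Set.Ici (y : ℝ) ⊆
        connectedComponentIn (carrierOf D)ᶜ (squareCenter (x, y)) := by
      refine (isPreconnected_vertical x isPreconnected_Ici).subset_connectedComponentIn
        ⟨y, Set.mem_Ici.2 le_rfl, rfl⟩ ?_
      rintro _ ⟨t, ht, rfl⟩ h
      obtain ⟨j, rfl, hj⟩ := hD.exists_hEdge_mem h
      have h1 : j < M := (abs_lt.1 (hM.hEdge hj).2).2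
      have h2 : (j : ℝ) ≤ y := by exact_mod_cast (by omega : j ≤ y)
      simp only [Set.mem_Ici] at ht
      linarith
    have h1 := (hb.subset hsub).image_snd
    rw [Set.image_image] at h1
    simp only [Set.image_id'] at h1
    exact not_bddAbove_Ici _ h1.bddAbove
  rcases le_total M y with h | h
  · exact htop y h
  · induction y, h using Int.leInductionDown with
    | base => exact htop M le_rfl
    | pred y _ ih =>
      replace ih : squareCenter (x, y) ∈ interiorOf D ↔ crossParity D M x y = 1 := ih
      rw [crossParity_sub_one hM]
      by_cases he : hEdge x y ∈ D
      · rw [edgeInd_of_mem he]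
        have hflip : squareCenter (x, y - 1) ∈ interiorOf D ↔
            squareCenter (x, y) ∉ interiorOf D := by
          obtain ⟨⟨w, hw, hwi⟩, w', hw', hwe⟩ := hsep _ he
          have h1 := hD.center_mem_interiorOf hwi
          have h2 := hD.center_mem_exteriorOf hwe
          have h3 : squareCenter w' ∉ interiorOf D := fun h => h2.2 h.2
          rw [hEdge_mem_squareEdges] at hw hw'
          rcases hw with rfl | rfl <;> rcases hw' with rfl | rfl <;> tauto
        rw [hflip, ih]
        generalize crossParity D M x y = a
        revert a
        decide
      · rw [edgeInd_of_notMem he, add_zero, ← ih]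
        refine mem_interiorOf_iff_of_isPreconnected
          (isPreconnected_vertical x (isPreconnected_Icc (a := (y : ℝ) - 1) (b := y))) ?_
          ⟨(y : ℝ) - 1, by simp, by simp [squareCenter]⟩ ⟨y, by simp, rfl⟩
        rw [Set.disjoint_left]
        rintro _ ⟨t, ht, rfl⟩ h
        obtain ⟨j, rfl, hj⟩ := hD.exists_hEdge_mem h
        simp only [Set.mem_Icc] at ht
        have h1 : y = j := by
          have h1 : j - 1 < y := by
            rify; linarith
          have h2 : y < j + 1 := by
            rify; linarith
          omega
        exact he (h1 ▸ hj)

theorem isOutermostCycleOf.separates {ω : GridV → Prop} {z : GridV} {D : Set (Sym2 GridV)}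
    (h : isOutermostCycleOf ω z D) : Separates D := fun e he =>
  ⟨(h.2.2.1 e he).1.imp fun _ hw => hw.2, (h.2.2.1 e he).2.imp fun _ hw => hw.2⟩

/-- A cycle of `G_C` sharing two vertices with an outermost cycle is enclosed by it. -/
theorem isOutermostCycleOf.encloses {ω : GridV → Prop} {z : GridV} {D D' : Set (Sym2 GridV)}
    (h : isOutermostCycleOf ω z D) (hD' : IsCycleIn (gcEdges ω) D') {x y : GridV} (hxy : x ≠ y)
    (hx : x ∈ vertexSetOf D) (hx' : x ∈ vertexSetOf D') (hy : y ∈ vertexSetOf D)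
    (hy' : y ∈ vertexSetOf D') : ∀ e ∈ D', e ∈ D ∨ inInterior D (edgeSeg e) := by
  intro e he'
  by_contra hcon
  rw [not_or] at hcon
  obtain ⟨C₁, C₂, hC₁, hC₂, hs₁, hs₂, he₁, he₂, hsum⟩ :=
    exists_theta h.1.1 hD'.1 hxy hx hx' hy hy' he' hcon.1
  have hG := Set.union_subset h.1.2 hD'.2
  obtain ⟨M₀, h₀⟩ := h.1.1.exists_edgeBound
  obtain ⟨M₁, h₁⟩ := hC₁.exists_edgeBound
  obtain ⟨M₂, h₂⟩ := hC₂.exists_edgeBound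
  set M := max M₀ (max M₁ M₂)
  have hodd := (mem_interiorOf_iff_crossParity h.1.1 h.separates (h₀ M (by omega)) z.1 z.2).1
    (h.1.1.center_mem_interiorOf h.2.1)
  rw [crossParity_eq_add hsum] at hodd
  have hkey : ∀ C, IsCycle C → C ⊆ D ∪ D' → e ∈ C → EdgeBound C M →
      crossParity C M z.1 z.2 = 0 := by
    intro C hC hs he hM
    by_contra hne
    have := h.2.2.2 C ⟨hC, hs.trans hG⟩ (hC.inInterior_of_crossParity_ne hM hne) e he
    exact this.elim hcon.1 hcon.2
  rw [hkey C₁ hC₁ hs₁ he₁ (h₁ M (by omega)), hkey C₂ hC₂ hs₂ he₂ (h₂ M (by omega))] at hodd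
  simp at hodd

theorem exteriorOf_subset {D D' : Set (Sym2 GridV)}
    (h : ∀ e ∈ D', e ∈ D ∨ inInterior D (edgeSeg e)) : exteriorOf D ⊆ exteriorOf D' := by
  rintro p ⟨hp, hb⟩
  have hsub : connectedComponentIn (carrierOf D)ᶜ p ⊆ (carrierOf D')ᶜ := by
    intro q hq hqD'
    have hqD : q ∉ carrierOf D := connectedComponentIn_subset _ _ hq
    obtain ⟨e, he, hqe⟩ := mem_carrierOf.1 hqD'
    rcases h e he with h1 | h1
    · exact hqD (mem_carrierOf.2 ⟨e, h1, hqe⟩)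
    · have h2 := ((h1 hqe).resolve_right hqD).2
      rw [← connectedComponentIn_eq hq] at h2
      exact hb h2
  have hpp := mem_connectedComponentIn (show p ∈ (carrierOf D)ᶜ from hp)
  exact ⟨hsub hpp, fun hb' => hb (hb'.subset
    (isPreconnected_connectedComponentIn.subset_connectedComponentIn hpp hsub))⟩

theorem IsCycle.center_mem_interiorOf_of_edge {D : Set (Sym2 GridV)} (hD : IsCycle D)
    {u v : GridV} (hadj : GridAdj u v) (he : s(u, v) ∉ D) (hi : inInterior D (edgeSeg s(u, v)))
    {w : GridV} (hw : s(u, v) ∈ squareEdges w) : squareCenter w ∈ interiorOf D := by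
  rcases hadj.eq_hEdge_or_vEdge with ⟨x, y, h⟩ | ⟨x, y, h⟩ <;> rw [h] at he hi hw
  · have hw1 : w.1 = x ∧ (w.2 = y ∨ w.2 = y - 1) := by
      rcases hEdge_mem_squareEdges.1 hw with rfl | rfl <;> simp
    have hm : ((x : ℝ), (y : ℝ) - 1 / 2) ∉ carrierOf D := by
      intro hm
      obtain ⟨j, h1, hj⟩ := hD.exists_hEdge_mem hm
      have : y = j := by
        rify; linarith
      exact he (this ▸ hj)
    have hm' : ((x : ℝ), (y : ℝ) - 1 / 2) ∈ interiorOf D := by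
      refine (hi ?_).resolve_right hm
      rw [mem_edgeSeg_hEdge]
      exact ⟨by linarith, by linarith, rfl⟩
    refine (mem_interiorOf_iff_of_isPreconnected
      (isPreconnected_vertical x (Set.OrdConnected.isPreconnected
        (Set.ordConnected_uIcc (a := (y : ℝ) - 1 / 2) (b := w.2)))) ?_
      ⟨_, Set.left_mem_uIcc, rfl⟩ ⟨_, Set.right_mem_uIcc, ?_⟩).1 hm'
    · rw [Set.disjoint_left]
      rintro _ ⟨t, ht, rfl⟩ hc
      obtain ⟨j, rfl, hj⟩ := hD.exists_hEdge_mem hc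
      refine he ?_
      have : y = j := by
        rw [Set.mem_uIcc] at ht
        rcases hw1.2 with h2 | h2 <;> rw [h2] at ht <;> push_cast at ht
        all_goals
          have h3 : j < y + 1 := by
            rify; rcases ht with ht | ht <;> linarith
          have h4 : y < j + 1 := by
            rify; rcases ht with ht | ht <;> linarith
          omega
      exact this ▸ hj
    · simp [squareCenter, hw1.1]
  · have hw1 : w.2 = y ∧ (w.1 = x ∨ w.1 = x - 1) := by
      rcases vEdge_mem_squareEdges.1 hw with rfl | rfl <;> simp
    have hm : ((x : ℝ) - 1 / 2, (y : ℝ)) ∉ carrierOf D := by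
      intro hm
      obtain ⟨j, h1, hj⟩ := hD.exists_vEdge_mem hm
      have : x = j := by
        rify; linarith
      exact he (this ▸ hj)
    have hm' : ((x : ℝ) - 1 / 2, (y : ℝ)) ∈ interiorOf D := by
      refine (hi ?_).resolve_right hm
      rw [mem_edgeSeg_vEdge]
      exact ⟨rfl, by linarith, by linarith⟩
    refine (mem_interiorOf_iff_of_isPreconnected
      (isPreconnected_horizontal y (Set.OrdConnected.isPreconnected
        (Set.ordConnected_uIcc (a := (x : ℝ) - 1 / 2) (b := w.1)))) ?_
      ⟨_, Set.left_mem_uIcc, rfl⟩ ⟨_, Set.right_mem_uIcc, ?_⟩).1 hm'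
    · rw [Set.disjoint_left]
      rintro _ ⟨t, ht, rfl⟩ hc
      obtain ⟨j, rfl, hj⟩ := hD.exists_vEdge_mem hc
      refine he ?_
      have : x = j := by
        rw [Set.mem_uIcc] at ht
        rcases hw1.2 with h2 | h2 <;> rw [h2] at ht <;> push_cast at ht
        all_goals
          have h3 : j < x + 1 := by
            rify; rcases ht with ht | ht <;> linarith
          have h4 : x < j + 1 := by
            rify; rcases ht with ht | ht <;> linarith
          omega
      exact this ▸ hj
    · simp [squareCenter, hw1.1]

theorem subset_of_mutually_enclosed {D D' : Set (Sym2 GridV)} (hD : IsCycle D) (hD' : IsCycle D')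
    (hsep : Separates D) (h : ∀ e ∈ D', e ∈ D ∨ inInterior D (edgeSeg e))
    (h' : ∀ e ∈ D, e ∈ D' ∨ inInterior D' (edgeSeg e)) : D ⊆ D' := by
  intro e he
  by_contra he'
  have hi := (h' e he).resolve_left he'
  obtain ⟨-, w, hw, hext⟩ := hsep e he
  have h1 := exteriorOf_subset h (hD.center_mem_exteriorOf hext)
  induction e with | _ u v
  exact h1.2 (hD'.center_mem_interiorOf_of_edge (hD.gridAdj he) he' hi hw).2

/-- Outermost cycles sharing an edge coincide. -/
theorem isOutermostCycleOf.eq_of_common_edge {ω : GridV → Prop} {z z' : GridV}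
    {D D' : Set (Sym2 GridV)} (h : isOutermostCycleOf ω z D) (h' : isOutermostCycleOf ω z' D')
    {u v : GridV} (he : s(u, v) ∈ D) (he' : s(u, v) ∈ D') : D = D' := by
  have huv : u ≠ v := by
    rintro rfl
    have := h.1.1.gridAdj he
    simp [GridAdj] at this
  have hu : u ∈ vertexSetOf D := ⟨_, he, Sym2.mem_mk_left _ _⟩
  have hv : v ∈ vertexSetOf D := ⟨_, he, Sym2.mem_mk_right _ _⟩
  have hu' : u ∈ vertexSetOf D' := ⟨_, he', Sym2.mem_mk_left _ _⟩
  have hv' : v ∈ vertexSetOf D' := ⟨_, he', Sym2.mem_mk_right _ _⟩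
  have h1 := h.encloses h'.1 huv hu hu' hv hv'
  have h2 := h'.encloses h.1 huv hu' hu hv' hv
  exact (subset_of_mutually_enclosed h.1.1 h'.1.1 h.separates h1 h2).antisymm
    (subset_of_mutually_enclosed h'.1.1 h.1.1 h'.separates h2 h1)

/-- If `C(0)` is finite and nonempty, no three pairwise distinct
outermost boundary cycles of `C(0)` share a common vertex. -/
theorem no_three_outermost_cycles_meet (ω : GridV → Prop)
    (hfin : (starComp ω).Finite) (hne : (starComp ω).Nonempty)
    (D₁ D₂ D₃ : Set (Sym2 GridV))
    (h₁ : ∃ z ∈ starComp ω, isOutermostCycleOf ω z D₁)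
    (h₂ : ∃ z ∈ starComp ω, isOutermostCycleOf ω z D₂)
    (h₃ : ∃ z ∈ starComp ω, isOutermostCycleOf ω z D₃)
    (h₁₂ : D₁ ≠ D₂) (h₁₃ : D₁ ≠ D₃) (h₂₃ : D₂ ≠ D₃) :
    ¬ ∃ v, v ∈ vertexSetOf D₁ ∧ v ∈ vertexSetOf D₂ ∧ v ∈ vertexSetOf D₃ := by
  rintro ⟨v, hv₁, hv₂, hv₃⟩
  obtain ⟨z₁, -, h₁⟩ := h₁
  obtain ⟨z₂, -, h₂⟩ := h₂
  obtain ⟨z₃, -, h₃⟩ := h₃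
  obtain ⟨a₁, b₁, hab₁, ha₁, hb₁, he₁⟩ := h₁.1.1.exists_two_neighbors hv₁
  obtain ⟨a₂, b₂, hab₂, ha₂, hb₂, he₂⟩ := h₂.1.1.exists_two_neighbors hv₂
  obtain ⟨a₃, b₃, hab₃, ha₃, hb₃, he₃⟩ := h₃.1.1.exists_two_neighbors hv₃
  have d₁₂ : ∀ w, s(v, w) ∈ D₁ → s(v, w) ∉ D₂ := fun w hw hw' =>
    h₁₂ (h₁.eq_of_common_edge h₂ hw hw')
  have d₁₃ : ∀ w, s(v, w) ∈ D₁ → s(v, w) ∉ D₃ := fun w hw hw' =>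
    h₁₃ (h₁.eq_of_common_edge h₃ hw hw')
  have d₂₃ : ∀ w, s(v, w) ∈ D₂ → s(v, w) ∉ D₃ := fun w hw hw' =>
    h₂₃ (h₂.eq_of_common_edge h₃ hw hw')
  simp only [he₁, he₂, he₃, not_or] at d₁₂ d₁₃ d₂₃
  have e₁ := d₁₂ a₁ (.inl rfl)
  have e₂ := d₁₂ b₁ (.inr rfl)
  have e₃ := d₁₃ a₁ (.inl rfl)
  have e₄ := d₁₃ b₁ (.inr rfl)
  have e₅ := d₂₃ a₂ (.inl rfl)
  have e₆ := d₂₃ b₂ (.inr rfl)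
  have hcard : ({a₁, b₁, a₂, b₂, a₃, b₃} : Finset GridV).card = 6 := by
    simp [Finset.card_insert_of_notMem, *]
  have hsub : ({a₁, b₁, a₂, b₂, a₃, b₃} : Finset GridV) ⊆
      {(v.1 + 1, v.2), (v.1 - 1, v.2), (v.1, v.2 + 1), (v.1, v.2 - 1)} := by
    intro w hw
    have hadj : GridAdj v w := by
      simp only [Finset.mem_insert, Finset.mem_singleton] at hw
      rcases hw with rfl | rfl | rfl | rfl | rfl | rfl <;> assumption
    simpa using hadj.cases
  have := (Finset.card_le_card hsub).trans Finset.card_le_four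
  omega
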